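/- Let X be a locally compact Hausdorff space, H a separable complex Hilbert space, and p ∈ [1,∞). If T ∈ C₀(X, S_p(H)) and T' : X → B(H) is bounded and *-strongly continuous, then the pointwise products x ↦ T'(x)T(x) and x ↦ T(x)T'(x) both belong to C₀(X, S_p(H)); that is, C₀(X, S_p(H)) is a two-sided ideal in the algebra of bounded *-strongly continuous B(H)-valued maps on X. -/

import Mathlib

open ContinuousLinearMap Filter Topology

noncomputable section

variable {H : Type*} [NormedAddCommGroup H] [InnerProductSpace ℂ H] [CompleteSpace H]
  [TopologicalSpace.SeparableSpace H]

local notation "⟪" x ", " y "⟫" => @inner ℂ _ _ x y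

/-- `|T|^p = (T*T)^{p/2}`, via the continuous functional calculus. -/
def absPow (T : H →L[ℂ] H) (p : ℝ) : H →L[ℂ] H :=
  cfc (fun t : ℝ => t ^ (p / 2)) (ContinuousLinearMap.adjoint T ∘L T)

/-- The trace `∑ᵢ ⟨fᵢ, A fᵢ⟩ ∈ [0,∞]` of a positive operator `A`, computed in the
orthonormal basis `f` (for positive `A` the value is independent of the basis). -/
def posTr (f : HilbertBasis ℕ ℂ H) (A : H →L[ℂ] H) : ENNReal :=
  ∑' i, ENNReal.ofReal (RCLike.re ⟪f i, A (f i)⟫)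

/-- `tr |T|^p ∈ [0,∞]`. `T` lies in the Schatten class `S_p(H)` iff this is finite. -/
def trAbsPow (f : HilbertBasis ℕ ℂ H) (T : H →L[ℂ] H) (p : ℝ) : ENNReal :=
  posTr f (absPow T p)

/-- The Schatten `p`-norm `‖T‖_p = (tr |T|^p)^{1/p}`. -/
def sNorm (f : HilbertBasis ℕ ℂ H) (p : ℝ) (T : H →L[ℂ] H) : ℝ :=
  (trAbsPow f T p).toReal ^ (1 / p)

/-- `T : X → B(H)` belongs to `C₀(X, S_p(H))`: pointwise Schatten class, continuous
with respect to the Schatten `p`-norm, and vanishing at infinity with respect to it. -/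
def IsC0Schatten (f : HilbertBasis ℕ ℂ H) (p : ℝ) {X : Type*} [TopologicalSpace X]
    (T : X → H →L[ℂ] H) : Prop :=
  (∀ x, trAbsPow f (T x) p ≠ ⊤) ∧
  (∀ x, Tendsto (fun y => sNorm f p (T y - T x)) (nhds x) (nhds 0)) ∧
  Tendsto (fun x => sNorm f p (T x)) (cocompact X) (nhds 0)

section Compact

variable {E : Type*} [NormedAddCommGroup E] [InnerProductSpace ℂ E]

theorem HilbertBasis.hasSum_norm_inner_sq {ι : Type*} (b : HilbertBasis ι ℂ E) (x : E) :
    HasSum (fun i => ‖inner ℂ (b i) x‖ ^ 2) (‖x‖ ^ 2) := by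
  have h := (b.hasSum_inner_mul_inner x x).mapL Complex.reCLM
  rw [← inner_self_eq_norm_sq (𝕜 := ℂ)]
  convert! h using 2 with i
  rw [← inner_conj_symm x, RCLike.conj_mul]
  simp [← Complex.ofReal_pow]

theorem HilbertBasis.tsum_enorm_inner_sq {ι : Type*} (b : HilbertBasis ι ℂ E) (x : E) :
    ∑' i, ‖inner ℂ (b i) x‖ₑ ^ 2 = ‖x‖ₑ ^ 2 := by
  have h := b.hasSum_norm_inner_sq x
  simp_rw [← ofReal_norm, ← ENNReal.ofReal_pow (norm_nonneg _)]
  rw [← h.tsum_eq, ENNReal.ofReal_tsum_of_nonneg (fun _ => by positivity) h.summable]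

theorem Orthonormal.inner_eq_zero_of_mem_span_image {ι : Type*} {v : ι → E}
    (hv : Orthonormal ℂ v) {s : Set ι} {i : ι} (hi : i ∉ s) {x : E}
    (hx : x ∈ Submodule.span ℂ (v '' s)) : inner ℂ (v i) x = 0 := by
  induction hx using Submodule.span_induction with
  | mem x hx =>
    obtain ⟨j, hj, rfl⟩ := hx
    exact hv.2 (fun h => hi (h ▸ hj))
  | zero => simp
  | add x y _ _ hx hy => rw [inner_add_right, hx, hy, add_zero]
  | smul a x _ hx => rw [inner_smul_right, hx, mul_zero]

theorem isCompactOperator_starProjection (V : Submodule ℂ E) [FiniteDimensional ℂ V] :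
    IsCompactOperator V.starProjection :=
  (isCompactOperator_of_locallyCompactSpace_rng V.subtypeL).comp_clm V.orthogonalProjectionOnto

theorem tendsto_norm_comp_of_isCompactOperator {K : E →L[ℂ] E} (hK : IsCompactOperator K)
    {α : Type*} {l : Filter α} {D : α → E →L[ℂ] E} {M : ℝ} (hM0 : 0 < M)
    (hM : ∀ y, ‖D y‖ ≤ M) (hD : ∀ h, Tendsto (fun y => D y h) l (𝓝 0)) :
    Tendsto (fun y => ‖D y ∘L K‖) l (𝓝 0) := by
  refine Metric.tendsto_nhds.2 fun ε hε => ?_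
  obtain ⟨t, htfin, ht⟩ := Metric.totallyBounded_iff.1
    ((hK.isCompact_closure_image_closedBall 1).totallyBounded.subset subset_closure)
    (ε / (4 * M)) (by positivity)
  filter_upwards [(Filter.eventually_all_finite htfin).2 fun z _ =>
    (hD z).norm.eventually (gt_mem_nhds (by rw [norm_zero]; positivity : ‖(0 : E)‖ < ε / 4))]
    with y hy
  rw [dist_zero_right, norm_norm]
  refine lt_of_le_of_lt (opNorm_le_of_unit_norm (by positivity : 0 ≤ ε / 2) fun x hx => ?_)
    (half_lt_self hε)
  obtain ⟨z, hz, hxz⟩ := Set.mem_iUnion₂.1 (ht ⟨x, by simp [hx], rfl⟩)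
  rw [Metric.mem_ball, dist_eq_norm] at hxz
  calc ‖(D y ∘L K) x‖ = ‖D y (K x - z) + D y z‖ := by simp
    _ ≤ ‖D y (K x - z)‖ + ‖D y z‖ := norm_add_le _ _
    _ ≤ M * (ε / (4 * M)) + ε / 4 := by
      gcongr
      · exact (D y).le_of_opNorm_le_of_le (hM y) hxz.le
      · exact (hy z hz).le
    _ = ε / 2 := by
      field_simp
      ring

variable [CompleteSpace E]

theorem norm_sq_le_norm_adjoint_comp_self (T : E →L[ℂ] E) (x : E) :
    ‖T x‖ ^ 2 ≤ ‖(adjoint T ∘L T) x‖ * ‖x‖ := by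
  rw [← inner_self_eq_norm_sq (𝕜 := ℂ), ← adjoint_inner_left]
  exact (RCLike.re_le_norm _).trans (norm_inner_le_norm _ _)

theorem IsCompactOperator.of_adjoint_comp_self {T : E →L[ℂ] E}
    (h : IsCompactOperator (adjoint T ∘L T)) : IsCompactOperator T := by
  have h1 := (isCompactOperator_iff_isCompact_closure_image_ball
    ((adjoint T ∘L T : E →L[ℂ] E) : E →ₗ[ℂ] E) one_pos).1 h
  refine (isCompactOperator_iff_isCompact_closure_image_ball (T : E →ₗ[ℂ] E) one_pos).2 ?_
  have h2 := h1.totallyBounded.subset subset_closure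
  refine (TotallyBounded.closure ?_).isCompact_of_isClosed isClosed_closure
  rw [Metric.totallyBounded_iff]
  intro ε hε
  obtain ⟨t, hts, htf, ht⟩ := totallyBounded_iff_subset.1 h2 _
    (Metric.dist_mem_uniformity (show 0 < ε ^ 2 / 2 by positivity))
  obtain ⟨u, hus, huf, rfl⟩ := (Set.exists_subset_image_finite_and
    (p := fun s => s = t)).1 ⟨t, hts, htf, rfl⟩
  refine ⟨T '' u, huf.image _, ?_⟩
  rintro _ ⟨x, hx, rfl⟩
  have hx' := ht ⟨x, hx, rfl⟩
  simp only [Set.mem_iUnion, Set.mem_image, Set.mem_ofPred_eq, exists_prop] at hx'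
  obtain ⟨_, ⟨y, hy, rfl⟩, hxy⟩ := hx'
  refine Set.mem_iUnion₂.2 ⟨T y, ⟨y, hy, rfl⟩, ?_⟩
  have hxy2 : ‖x - y‖ ≤ 2 := by
    have := hus hy
    simp only [Metric.mem_ball, dist_zero_right] at this hx
    linarith [norm_sub_le x y]
  simp only [coe_coe, dist_eq_norm, ← map_sub] at hxy
  simp only [coe_coe, Metric.mem_ball, dist_eq_norm, ← map_sub]
  refine lt_of_pow_lt_pow_left₀ 2 hε.le ?_
  calc ‖T (x - y)‖ ^ 2 ≤ ‖(adjoint T ∘L T) (x - y)‖ * ‖x - y‖ :=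
        norm_sq_le_norm_adjoint_comp_self T _
    _ ≤ ‖(adjoint T ∘L T) (x - y)‖ * 2 := by gcongr
    _ < ε ^ 2 := by linarith

theorem tsum_enorm_sq_apply_eq_adjoint {ι κ : Type*} (b : HilbertBasis ι ℂ E)
    (c : HilbertBasis κ ℂ E) (R : E →L[ℂ] E) :
    ∑' i, ‖R (b i)‖ₑ ^ 2 = ∑' j, ‖adjoint R (c j)‖ₑ ^ 2 := by
  simp_rw [← c.tsum_enorm_inner_sq (R _), ← b.tsum_enorm_inner_sq (adjoint R _)]
  rw [ENNReal.tsum_comm]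
  congr! 5 with j i
  rw [adjoint_inner_right, ← ofReal_norm, ← ofReal_norm, norm_inner_symm]

theorem isCompactOperator_of_tsum_enorm_sq_ne_top {ι : Type*} (b : HilbertBasis ι ℂ E)
    {R : E →L[ℂ] E} (h : ∑' i, ‖adjoint R (b i)‖ₑ ^ 2 ≠ ⊤) : IsCompactOperator R := by
  classical
  let V (s : Finset ι) : Submodule ℂ E := Submodule.span ℂ (b '' s)
  have hV (s : Finset ι) : FiniteDimensional ℂ (V s) :=
    FiniteDimensional.span_of_finite ℂ (s.finite_toSet.image b)
  have key (s : Finset ι) (y : E) : ‖(R - (V s).starProjection ∘L R) y‖ₑ ^ 2 ≤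
      (∑' i : { i // i ∉ s }, ‖adjoint R (b i)‖ₑ ^ 2) * ‖y‖ₑ ^ 2 := by
    rw [← b.tsum_enorm_inner_sq, ← ENNReal.tsum_mul_right]
    refine le_of_le_of_eq ?_
      (tsum_subtype {i | i ∉ s} fun i => ‖adjoint R (b i)‖ₑ ^ 2 * ‖y‖ₑ ^ 2).symm
    refine ENNReal.tsum_le_tsum fun i => ?_
    by_cases hi : i ∈ s
    · have : inner ℂ (b i) ((R - (V s).starProjection ∘L R) y) = 0 :=
        Submodule.sub_starProjection_mem_orthogonal (K := V s) (R y) _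
          (Submodule.subset_span ⟨i, hi, rfl⟩)
      rw [this]
      simp
    · have h0 : (V s).starProjection (b i) = 0 := by
        rw [Submodule.starProjection_apply_eq_zero_iff, Submodule.mem_orthogonal]
        intro u hu
        rw [inner_eq_zero_symm]
        exact b.orthonormal.inner_eq_zero_of_mem_span_image (by simpa using hi) hu
      have h1 : inner ℂ (b i) ((R - (V s).starProjection ∘L R) y) =
          inner ℂ (adjoint R (b i)) y := by
        rw [sub_apply, comp_apply, inner_sub_right, ← Submodule.inner_starProjection_left_eq_right,
          h0, inner_zero_left, sub_zero, adjoint_inner_left]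
      rw [h1, Set.indicator_of_mem (by exact hi), ← mul_pow]
      gcongr
      simp_rw [← ofReal_norm]
      rw [← ENNReal.ofReal_mul (norm_nonneg _)]
      exact ENNReal.ofReal_le_ofReal (norm_inner_le_norm _ _)
  have hlim := ENNReal.tendsto_tsum_compl_atTop_zero h
  refine isCompactOperator_of_tendsto (F := fun s : Finset ι => (V s).starProjection ∘L R)
    (l := atTop) ?_ (Eventually.of_forall fun s =>
      (isCompactOperator_starProjection (V s)).comp_clm R)
  rw [Metric.tendsto_nhds]
  intro ε hε
  filter_upwards [hlim.eventually_lt_const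
    (show 0 < ENNReal.ofReal ((ε / 2) ^ 2) by positivity)] with s hs
  rw [dist_comm, dist_eq_norm]
  refine (opNorm_le_bound _ (half_pos hε).le fun y => ?_).trans_lt (half_lt_self hε)
  have h2 := (key s y).trans (mul_le_mul_left hs.le _)
  rw [← ofReal_norm, ← ofReal_norm, ENNReal.ofReal_pow (half_pos hε).le, ← mul_pow,
    ← ENNReal.ofReal_mul (half_pos hε).le] at h2
  have h3 := (ENNReal.pow_le_pow_left_iff two_ne_zero).1 h2
  exact (ENNReal.ofReal_le_ofReal_iff (by positivity)).1 h3

/-- Spectral theorem for compact self-adjoint operators. -/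
theorem IsCompactOperator.exists_hilbertBasis_eigenvectors {A : E →L[ℂ] E}
    (hA : IsCompactOperator A) (hsymm : (A : E →ₗ[ℂ] E).IsSymmetric) :
    ∃ (w : Set E) (b : HilbertBasis w ℂ E), ∀ i, ∃ μ : ℂ, A (b i) = μ • b i := by
  let V (μ : ℂ) : Submodule ℂ E := Module.End.eigenspace (A : E →ₗ[ℂ] E) μ
  have hV (μ : ℂ) : CompleteSpace (V μ) := by
    refine IsClosed.completeSpace_coe (hs := ?_)
    have : (V μ : Set E) = {x | A x = μ • x} := by
      ext x
      exact Module.End.mem_eigenspace_iff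
    rw [this]
    exact isClosed_eq A.continuous (continuous_const_smul μ)
  choose w c hc using fun μ : ℂ => exists_hilbertBasis ℂ (V μ)
  let v : (Σ μ, w μ) → E := fun a => c a.1 a.2
  have hon : Orthonormal ℂ v :=
    hsymm.orthogonalFamily_eigenspaces.orthonormal_sigma_orthonormal
      (v_family := fun μ => c μ) (fun μ => (c μ).orthonormal)
  have hbot : (Submodule.span ℂ (Set.range ((↑) : Set.range v → E)))ᗮ = ⊥ := by
    rw [Subtype.range_coe, eq_bot_iff, ← orthogonalComplement_iSup_eigenspaces_eq_bot hA hsymm]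
    intro x hx
    rw [← Submodule.iInf_orthogonal, Submodule.mem_iInf]
    intro μ
    rw [Submodule.mem_orthogonal']
    intro y hy
    have h := ((c μ).hasSum_repr ⟨y, hy⟩).mapL (innerSL ℂ x ∘L (V μ).subtypeL)
    refine h.unique (hasSum_zero.congr_fun fun i => ?_)
    have hi : inner ℂ x (c μ i : E) = 0 :=
      (Submodule.mem_orthogonal' _ x).1 hx _ (Submodule.subset_span ⟨⟨μ, i⟩, rfl⟩)
    simp [hi]
  refine ⟨_, HilbertBasis.mkOfOrthogonalEqBot hon.toSubtypeRange hbot, ?_⟩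
  rw [HilbertBasis.coe_mkOfOrthogonalEqBot]
  rintro ⟨_, a, rfl⟩
  exact ⟨a.1, Module.End.mem_eigenspace_iff.1 (c a.1 a.2).2⟩

/-- The singular value decomposition of a compact operator. -/
theorem IsCompactOperator.exists_hilbertBasis_adjoint_comp_self {T : E →L[ℂ] E}
    (hT : IsCompactOperator T) :
    ∃ (w : Set E) (b : HilbertBasis w ℂ E),
      ∀ i, (adjoint T ∘L T) (b i) = ((‖T (b i)‖ ^ 2 : ℝ) : ℂ) • b i := by
  obtain ⟨w, b, hb⟩ := IsCompactOperator.exists_hilbertBasis_eigenvectors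
    (A := adjoint T ∘L T) (hT.clm_comp (adjoint T))
    (isPositive_adjoint_comp_self T).isSymmetric
  refine ⟨w, b, fun i => ?_⟩
  obtain ⟨μ, hμ⟩ := hb i
  have h : inner ℂ (b i) ((adjoint T ∘L T) (b i)) = μ := by
    rw [hμ, inner_smul_right, inner_self_eq_norm_sq_to_K, b.orthonormal.1 i]
    simp
  rw [comp_apply, adjoint_inner_right, inner_self_eq_norm_sq_to_K] at h
  rw [hμ, ← h]
  simp

end Compact

section Powers

variable {E : Type*} [NormedAddCommGroup E] [InnerProductSpace ℂ E] [CompleteSpace E]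

theorem cfc_apply_eigenvector {A : E →L[ℂ] E} (hA : IsSelfAdjoint A) {s : ℝ} {x : E}
    (hx : A x = (s : ℂ) • x) {g : ℝ → ℝ} (hg : ContinuousOn g (spectrum ℝ A)) :
    cfc g A x = (g s : ℂ) • x := by
  rcases eq_or_ne x 0 with rfl | hx0
  · simp
  have hs : s ∈ spectrum ℝ A := by
    rw [spectrum.mem_iff]
    rintro ⟨u, hu⟩
    apply hx0
    have h1 : (u : E →L[ℂ] E) x = 0 := by
      rw [hu, Algebra.algebraMap_eq_smul_one, sub_apply, hx]
      exact sub_self _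
    calc x = (((u⁻¹ : (E →L[ℂ] E)ˣ) : E →L[ℂ] E) * u) x := by simp
      _ = 0 := by rw [mul_apply_eq_comp, h1, map_zero]
  rw [cfc_apply g A hA hg]
  suffices h : ∀ f : C(spectrum ℝ A, ℝ), cfcHom hA f x = (f ⟨s, hs⟩ : ℂ) • x from h _
  intro f
  have hA' : Continuous fun f : C(spectrum ℝ A, ℝ) => cfcHom hA f x :=
    (apply ℂ E x).continuous.comp (cfcHom_continuous hA)
  induction f using ContinuousMap.induction_on_of_compact with
  | const r =>
    have h1 : cfcHom hA (ContinuousMap.const _ r) = algebraMap ℝ _ r :=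
      AlgHomClass.commutes (cfcHom hA) r
    rw [h1, Algebra.algebraMap_eq_smul_one]
    exact rfl
  | id => rw [cfcHom_id hA, hx]; rfl
  | star_id => rw [star_trivial, cfcHom_id hA, hx]; rfl
  | add f g hf hg => simp [hf, hg, add_smul]
  | mul f g hf hg =>
    rw [map_mul, mul_apply_eq_comp, hg, map_smul, hf, smul_smul, ContinuousMap.mul_apply,
      Complex.ofReal_mul, mul_comm]
  | frequently f h =>
    refine h.mem_of_closed (isClosed_eq hA' ?_)
    fun_prop

theorem continuous_rpow_const_of_pos {s : ℝ} (hs : 0 < s) : Continuous fun t : ℝ => t ^ s :=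
  Real.continuous_rpow_const hs.le

theorem isSelfAdjoint_adjoint_comp_self (T : E →L[ℂ] E) : IsSelfAdjoint (adjoint T ∘L T) :=
  IsSelfAdjoint.star_mul_self T

theorem cfc_rpow_comp_cfc_rpow (T : E →L[ℂ] E) {s u : ℝ} (hs : 0 < s) (hu : 0 < u) :
    cfc (fun t : ℝ => t ^ s) (adjoint T ∘L T) ∘L cfc (fun t : ℝ => t ^ u) (adjoint T ∘L T) =
      cfc (fun t : ℝ => t ^ (s + u)) (adjoint T ∘L T) := by
  have h := cfc_mul (fun t : ℝ => t ^ s) (fun t : ℝ => t ^ u) (adjoint T ∘L T)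
    (continuous_rpow_const_of_pos hs).continuousOn (continuous_rpow_const_of_pos hu).continuousOn
  refine h.symm.trans (cfc_congr fun t ht => ?_)
  have ht0 : 0 ≤ t := spectrum_nonneg_of_nonneg (star_mul_self_nonneg T) ht
  exact (Real.rpow_add_of_nonneg ht0 hs.le hu.le).symm

theorem adjoint_cfc (g : ℝ → ℝ) (A : E →L[ℂ] E) : adjoint (cfc g A) = cfc g A :=
  (cfc_predicate g A : IsSelfAdjoint _)

theorem adjoint_cfc_comp_self (T : E →L[ℂ] E) {s : ℝ} (hs : 0 < s) :
    adjoint (cfc (fun t : ℝ => t ^ s) (adjoint T ∘L T)) ∘L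
      cfc (fun t : ℝ => t ^ s) (adjoint T ∘L T) =
      cfc (fun t : ℝ => t ^ (2 * s)) (adjoint T ∘L T) := by
  rw [two_mul, ← cfc_rpow_comp_cfc_rpow T hs hs]
  rw [adjoint_cfc]

theorem IsCompactOperator.of_cfc_rpow {T : E →L[ℂ] E} {s : ℝ} (hs : 0 < s)
    (h : IsCompactOperator (cfc (fun t : ℝ => t ^ s) (adjoint T ∘L T) : E →L[ℂ] E)) :
    IsCompactOperator T := by
  have hk (k : ℕ) : IsCompactOperator
      (cfc (fun t : ℝ => t ^ (s / 2 ^ k)) (adjoint T ∘L T) : E →L[ℂ] E) := by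
    induction k with
    | zero => simpa using h
    | succ k ih =>
      refine IsCompactOperator.of_adjoint_comp_self ?_
      rw [adjoint_cfc_comp_self T (by positivity)]
      convert ih using 6
      rw [pow_succ]
      field_simp
  obtain ⟨k, hk1⟩ := pow_unbounded_of_one_lt s (one_lt_two (α := ℝ))
  have h1 : s / 2 ^ k < 1 := (div_lt_one (by positivity)).2 hk1
  refine IsCompactOperator.of_adjoint_comp_self ?_
  have h2 := cfc_rpow_comp_cfc_rpow T (sub_pos.2 h1) (u := s / 2 ^ k) (by positivity)
  simp only [sub_add_cancel, Real.rpow_one] at h2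
  rw [cfc_id' ℝ _ (isSelfAdjoint_adjoint_comp_self T)] at h2
  rw [← h2]
  exact (hk k).clm_comp _

end Powers

section Trace

variable {E : Type*} [NormedAddCommGroup E] [InnerProductSpace ℂ E] [CompleteSpace E]

theorem posTr_adjoint_comp_self (f : HilbertBasis ℕ ℂ E) (R : E →L[ℂ] E) :
    posTr f (adjoint R ∘L R) = ∑' i, ‖R (f i)‖ₑ ^ 2 := by
  unfold posTr
  congr! 2 with i
  rw [comp_apply, adjoint_inner_right, inner_self_eq_norm_sq, ENNReal.ofReal_pow (norm_nonneg _),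
    ofReal_norm]

theorem absPow_eq_adjoint_comp_self (T : E →L[ℂ] E) {p : ℝ} (hp : 0 < p) :
    absPow T p = adjoint (cfc (fun t : ℝ => t ^ (p / 4)) (adjoint T ∘L T)) ∘L
      cfc (fun t : ℝ => t ^ (p / 4)) (adjoint T ∘L T) := by
  rw [adjoint_cfc_comp_self T (by positivity), absPow]
  congr! 3
  ring

theorem isCompactOperator_of_trAbsPow_ne_top (f : HilbertBasis ℕ ℂ E) {p : ℝ} (hp : 0 < p)
    {T : E →L[ℂ] E} (h : trAbsPow f T p ≠ ⊤) : IsCompactOperator T := by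
  rw [trAbsPow, absPow_eq_adjoint_comp_self T hp, posTr_adjoint_comp_self] at h
  refine IsCompactOperator.of_cfc_rpow (s := p / 4) (by positivity)
    (isCompactOperator_of_tsum_enorm_sq_ne_top f ?_)
  rwa [adjoint_cfc]

theorem trAbsPow_eq_tsum (f : HilbertBasis ℕ ℂ E) {p : ℝ} (hp : 0 < p) {T : E →L[ℂ] E}
    {ι : Type*} (b : HilbertBasis ι ℂ E)
    (hb : ∀ i, (adjoint T ∘L T) (b i) = ((‖T (b i)‖ ^ 2 : ℝ) : ℂ) • b i) :
    trAbsPow f T p = ∑' i, ENNReal.ofReal (‖T (b i)‖ ^ p) := by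
  rw [trAbsPow, absPow_eq_adjoint_comp_self T hp, posTr_adjoint_comp_self,
    tsum_enorm_sq_apply_eq_adjoint f b, adjoint_cfc]
  congr! 2 with i
  rw [cfc_apply_eigenvector (isSelfAdjoint_adjoint_comp_self T) (hb i)
    (continuous_rpow_const_of_pos (by positivity)).continuousOn, enorm_smul,
    ← ofReal_norm (b i), b.orthonormal.1 i, ENNReal.ofReal_one, mul_one, ← ofReal_norm,
    ← ENNReal.ofReal_pow (norm_nonneg _), Complex.norm_real, Real.norm_of_nonneg (by positivity),
    ← Real.rpow_natCast, ← Real.rpow_natCast, ← Real.rpow_mul (by positivity),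
    ← Real.rpow_mul (by positivity)]
  congr 2
  push_cast
  ring

theorem trAbsPow_const_smul (f : HilbertBasis ℕ ℂ E) {p : ℝ} (hp : 0 < p) {T : E →L[ℂ] E}
    (hT : IsCompactOperator T) {c : ℝ} (hc : 0 ≤ c) :
    trAbsPow f ((c : ℂ) • T) p = ENNReal.ofReal (c ^ p) * trAbsPow f T p := by
  obtain ⟨w, b, hb⟩ := hT.exists_hilbertBasis_adjoint_comp_self
  rw [trAbsPow_eq_tsum f hp b hb, trAbsPow_eq_tsum f hp b fun i => ?_, ← ENNReal.tsum_mul_left]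
  · congr! 2 with i
    rw [← ENNReal.ofReal_mul (by positivity), smul_apply, norm_smul, Complex.norm_real,
      Real.norm_of_nonneg hc, Real.mul_rpow hc (norm_nonneg _)]
  · have h1 : (adjoint ((c : ℂ) • T) ∘L ((c : ℂ) • T)) (b i) =
        ((c : ℂ) * c) • (adjoint T ∘L T) (b i) := by
      rw [comp_apply, smul_apply, map_smul, map_smulₛₗ, smul_apply, smul_smul, Complex.conj_ofReal]
      rfl
    rw [h1, hb i, smul_smul, smul_apply, norm_smul, Complex.norm_real, Real.norm_of_nonneg hc]
    congr 1
    push_cast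
    ring

end Trace

section ApproxRank

variable {E : Type*} [NormedAddCommGroup E] [InnerProductSpace ℂ E]

/-- The least rank of an operator within distance `t` of `T`. For compact `T` this is the number of
singular values of `T` exceeding `t`. -/
def approxRank (T : E →L[ℂ] E) (t : ℝ) : ENNReal :=
  ⨅ (F : E →L[ℂ] E) (_ : FiniteDimensional ℂ F.range ∧ ‖T - F‖ ≤ t),
    (Module.finrank ℂ F.range : ENNReal)

theorem approxRank_le {T F : E →L[ℂ] E} {t : ℝ} {V : Submodule ℂ E} [FiniteDimensional ℂ V]
    (hF : ∀ x, F x ∈ V) (h : ‖T - F‖ ≤ t) : approxRank T t ≤ Module.finrank ℂ V := by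
  have hle : F.range ≤ V := by
    rintro _ ⟨x, rfl⟩
    exact hF x
  exact (iInf₂_le F ⟨Submodule.finiteDimensional_of_le hle, h⟩).trans
    (by exact_mod_cast Submodule.finrank_mono hle)

theorem approxRank_antitone (T : E →L[ℂ] E) : Antitone (approxRank T) := by
  refine fun s t hst => le_iInf₂ fun F ⟨_, hF⟩ => ?_
  exact approxRank_le (fun x => ⟨x, rfl⟩) (hF.trans hst)

theorem approxRank_eq_zero {T : E →L[ℂ] E} {t : ℝ} (h : ‖T‖ ≤ t) : approxRank T t = 0 := by
  have := approxRank_le (T := T) (F := 0) (V := ⊥) (fun x => by simp) (by simpa using h)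
  simpa using this

theorem approxRank_comp_left_le (T : E →L[ℂ] E) {A : E →L[ℂ] E} {c : ℝ} (hA : ‖A‖ ≤ c) (t : ℝ) :
    approxRank (A ∘L T) (c * t) ≤ approxRank T t := by
  refine le_iInf₂ fun F ⟨_, hF⟩ => ?_
  refine (approxRank_le (F := A ∘L F) (V := F.range.map (A : E →ₗ[ℂ] E))
    (fun x => ⟨F x, ⟨x, rfl⟩, rfl⟩) ?_).trans (by exact_mod_cast Submodule.finrank_map_le _ _)
  rw [← comp_sub]
  exact (opNorm_comp_le _ _).trans
    (mul_le_mul hA hF (norm_nonneg _) ((norm_nonneg _).trans hA))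

theorem approxRank_comp_right_le (T : E →L[ℂ] E) {A : E →L[ℂ] E} {c : ℝ} (hA : ‖A‖ ≤ c) (t : ℝ) :
    approxRank (T ∘L A) (c * t) ≤ approxRank T t := by
  refine le_iInf₂ fun F ⟨_, hF⟩ => ?_
  refine approxRank_le (F := F ∘L A) (fun x => ⟨A x, rfl⟩) ?_
  rw [← sub_comp, mul_comm]
  exact (opNorm_comp_le _ _).trans
    (mul_le_mul hF hA (norm_nonneg _) ((norm_nonneg _).trans hF))

theorem approxRank_div_le_smul (T : E →L[ℂ] E) {c : ℝ} (hc : 0 < c) (t : ℝ) :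
    approxRank T (t / c) ≤ approxRank ((c : ℂ) • T) t := by
  have hc' : (c : ℂ) ≠ 0 := Complex.ofReal_ne_zero.2 hc.ne'
  have h := approxRank_comp_left_le ((c : ℂ) • T) (A := ((c : ℂ)⁻¹) • ContinuousLinearMap.id ℂ E)
    (c := c⁻¹) ?_ t
  · rwa [smul_comp, id_comp, inv_smul_smul₀ hc', inv_mul_eq_div] at h
  · rw [norm_smul, norm_inv, Complex.norm_real, Real.norm_of_nonneg hc.le]
    exact mul_le_of_le_one_right (by positivity) norm_id_le

theorem approxRank_comp_left_le_smul (T : E →L[ℂ] E) {A : E →L[ℂ] E} {c : ℝ} (hc : 0 < c)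
    (hA : ‖A‖ ≤ c) (t : ℝ) : approxRank (A ∘L T) t ≤ approxRank ((c : ℂ) • T) t := by
  refine le_trans ?_ (approxRank_div_le_smul T hc t)
  simpa [mul_div_cancel₀ _ hc.ne'] using approxRank_comp_left_le T hA (t / c)

theorem approxRank_comp_right_le_smul (T : E →L[ℂ] E) {A : E →L[ℂ] E} {c : ℝ} (hc : 0 < c)
    (hA : ‖A‖ ≤ c) (t : ℝ) : approxRank (T ∘L A) t ≤ approxRank ((c : ℂ) • T) t := by
  refine le_trans ?_ (approxRank_div_le_smul T hc t)
  simpa [mul_div_cancel₀ _ hc.ne'] using approxRank_comp_right_le T hA (t / c)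

theorem approxRank_add_le (S T : E →L[ℂ] E) (s t : ℝ) :
    approxRank (S + T) (s + t) ≤ approxRank S s + approxRank T t := by
  unfold approxRank
  simp only [ENNReal.iInf_add, ENNReal.add_iInf]
  refine le_iInf₂ fun G hG => le_iInf₂ fun F hF => ?_
  have := hF.1
  have := hG.1
  refine (approxRank_le (F := F + G) (V := F.range ⊔ G.range) (fun x => ?_) ?_).trans ?_
  · exact Submodule.add_mem_sup ⟨x, rfl⟩ ⟨x, rfl⟩
  · rw [add_sub_add_comm]
    exact (norm_add_le _ _).trans (add_le_add hF.2 hG.2)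
  · exact_mod_cast Submodule.finrank_add_le_finrank_add_finrank _ _

theorem approxRank_add_le_two_smul (S T : E →L[ℂ] E) (t : ℝ) :
    approxRank (S + T) t ≤ approxRank (((2 : ℝ) : ℂ) • S) t + approxRank (((2 : ℝ) : ℂ) • T) t := by
  have h := approxRank_add_le S T (t / 2) (t / 2)
  rw [add_halves] at h
  exact h.trans (add_le_add (approxRank_div_le_smul S two_pos t)
    (approxRank_div_le_smul T two_pos t))

variable [CompleteSpace E]

theorem hasSum_norm_sq_apply {ι : Type*} {T : E →L[ℂ] E} {b : HilbertBasis ι ℂ E}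
    (hb : ∀ i, (adjoint T ∘L T) (b i) = ((‖T (b i)‖ ^ 2 : ℝ) : ℂ) • b i) (x : E) :
    HasSum (fun i => ‖T (b i)‖ ^ 2 * ‖inner ℂ (b i) x‖ ^ 2) (‖T x‖ ^ 2) := by
  have h := (b.hasSum_inner_mul_inner x ((adjoint T ∘L T) x)).mapL Complex.reCLM
  rw [← inner_self_eq_norm_sq (𝕜 := ℂ), ← adjoint_inner_right]
  convert! h using 2 with i
  have h1 : inner ℂ (b i) ((adjoint T ∘L T) x) = (‖T (b i)‖ ^ 2 : ℝ) * inner ℂ (b i) x := by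
    rw [comp_apply, adjoint_inner_right, ← adjoint_inner_left, ← comp_apply, hb,
      inner_smul_left, Complex.conj_ofReal]
  rw [h1, mul_left_comm, ← inner_conj_symm x, RCLike.conj_mul]
  simp [← Complex.ofReal_pow, ← Complex.ofReal_mul]

theorem approxRank_eq_encard {ι : Type*} {T : E →L[ℂ] E} {b : HilbertBasis ι ℂ E}
    (hb : ∀ i, (adjoint T ∘L T) (b i) = ((‖T (b i)‖ ^ 2 : ℝ) : ℂ) • b i) {t : ℝ} (ht : 0 ≤ t) :
    approxRank T t = ({i | t < ‖T (b i)‖}.encard : ENNReal) := by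
  refine le_antisymm ?_ (le_iInf₂ fun F ⟨hfin, hF⟩ => ?_)
  · rcases Set.finite_or_infinite {i | t < ‖T (b i)‖} with hJ | hJ
    swap
    · simp [hJ.encard_eq]
    set J := {i | t < ‖T (b i)‖}
    let V := Submodule.span ℂ (b '' J)
    have : FiniteDimensional ℂ V := FiniteDimensional.span_of_finite ℂ (hJ.image b)
    refine (approxRank_le (F := T ∘L V.starProjection) (V := V.map (T : E →ₗ[ℂ] E))
      (fun x => ⟨_, V.starProjection_apply_mem x, rfl⟩) ?_).trans ?_
    · refine opNorm_le_bound _ ht fun x => ?_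
      set y := x - V.starProjection x with hy
      have hyx : ‖y‖ ≤ ‖x‖ := by
        rw [hy, ← Submodule.starProjection_orthogonal_val]
        exact Vᗮ.norm_starProjection_apply_le x
      have hTy : (T - T ∘L V.starProjection) x = T y := by simp [hy]
      rw [hTy]
      refine le_trans ?_ (mul_le_mul_of_nonneg_left hyx ht)
      refine le_of_sq_le_sq ?_ (by positivity)
      rw [mul_pow]
      refine hasSum_le (fun i => ?_) (hasSum_norm_sq_apply hb y)
        ((b.hasSum_norm_inner_sq y).mul_left (t ^ 2))
      by_cases hi : i ∈ J
      · have h0 : inner ℂ (b i) y = 0 := V.sub_starProjection_mem_orthogonal x _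
          (Submodule.subset_span ⟨i, hi, rfl⟩)
        simp [h0]
      · have : ‖T (b i)‖ ≤ t := not_lt.1 hi
        gcongr
    · refine le_trans (b := (Module.finrank ℂ V : ENNReal))
        (by exact_mod_cast Submodule.finrank_map_le _ _) ?_
      have h1 : (Module.finrank ℂ V : ℕ∞) ≤ J.encard := by
        have : Fintype (b '' J) := (hJ.image b).fintype
        calc (Module.finrank ℂ V : ℕ∞) ≤ (b '' J).encard := by
              rw [Set.encard_eq_coe_toFinset_card]
              exact_mod_cast finrank_span_le_card (R := ℂ) (b '' J)
          _ ≤ J.encard := Set.encard_image_le b J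
      exact_mod_cast ENat.toENNReal_le.2 h1
  · by_contra! hlt
    have hlt' : ((Module.finrank ℂ F.range + 1 : ℕ) : ℕ∞) ≤ {i | t < ‖T (b i)‖}.encard := by
      rw [← ENat.toENNReal_coe, ENat.toENNReal_lt] at hlt
      push_cast
      exact Order.add_one_le_of_lt hlt
    obtain ⟨J, hJ, hJc⟩ := Set.exists_subset_encard_eq hlt'
    have hJfin : J.Finite := Set.finite_of_encard_eq_coe hJc
    let V := Submodule.span ℂ (b '' J)
    have : FiniteDimensional ℂ V := FiniteDimensional.span_of_finite ℂ (hJfin.image b)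
    have hV : Module.finrank ℂ V = Module.finrank ℂ F.range + 1 := by
      have : Fintype J := hJfin.fintype
      have hli := (b.orthonormal.comp _ (Subtype.val_injective (p := (· ∈ J)))).linearIndependent
      have h := finrank_span_eq_card hli
      rw [Set.range_comp, Subtype.range_coe] at h
      refine h.trans ?_
      rw [← Set.toFinset_card]
      exact_mod_cast (Set.encard_eq_coe_toFinset_card J).symm.trans hJc
    obtain ⟨⟨v, hv⟩, hFv, hv0⟩ := Submodule.exists_mem_ne_zero_of_ne_bot
      (LinearMap.ker_ne_bot_of_finrank_lt (f := (F : E →ₗ[ℂ] E).rangeRestrict ∘ₗ V.subtype)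
        (by rw [hV]; exact Nat.lt_succ_self _))
    have hFv' : F v = 0 := congrArg Subtype.val hFv
    have hTv : ‖T v‖ ≤ t * ‖v‖ := by
      have := (T - F).le_of_opNorm_le hF v
      simpa [hFv'] using this
    have hterm (i : ι) (hi : i ∉ J) : inner ℂ (b i) v = 0 :=
      b.orthonormal.inner_eq_zero_of_mem_span_image hi hv
    obtain ⟨i, hi⟩ : ∃ i, inner ℂ (b i) v ≠ 0 := by
      by_contra! h
      have h2 := b.hasSum_norm_inner_sq v
      simp only [h, norm_zero, ne_eq, two_ne_zero, not_false_eq_true, zero_pow] at h2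
      exact hv0 (Subtype.ext (norm_eq_zero.1 (pow_eq_zero_iff two_ne_zero |>.1
        (h2.unique hasSum_zero))))
    have hiJ : i ∈ J := by
      by_contra h
      exact hi (hterm i h)
    have hlt2 : t ^ 2 * ‖v‖ ^ 2 < ‖T v‖ ^ 2 := by
      refine hasSum_lt (i := i) (fun j => ?_) ?_ ((b.hasSum_norm_inner_sq v).mul_left (t ^ 2))
        (hasSum_norm_sq_apply hb v)
      · by_cases hj : j ∈ J
        · have : t < ‖T (b j)‖ := hJ hj
          dsimp only
          gcongr
        · simp [hterm j hj]
      · have : t < ‖T (b i)‖ := hJ hiJ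
        gcongr
    rw [← mul_pow] at hlt2
    exact hlt2.not_ge (pow_le_pow_left₀ (norm_nonneg _) hTv 2)

end ApproxRank

section Schatten

open MeasureTheory Set

variable {E : Type*} [NormedAddCommGroup E] [InnerProductSpace ℂ E] [CompleteSpace E]

theorem trAbsPow_eq_lintegral (f : HilbertBasis ℕ ℂ E) {p : ℝ} (hp : 0 < p) {T : E →L[ℂ] E}
    (hT : IsCompactOperator T) : trAbsPow f T p =
      ENNReal.ofReal p * ∫⁻ t in Ioi 0, approxRank T t * ENNReal.ofReal (t ^ (p - 1)) := by
  obtain ⟨w, b, hb⟩ := hT.exists_hilbertBasis_adjoint_comp_self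
  let _ : MeasurableSpace w := ⊤
  rw [trAbsPow_eq_tsum f hp b hb, ← lintegral_count, lintegral_rpow_eq_lintegral_meas_lt_mul _
    (Eventually.of_forall fun i => norm_nonneg (T (b i))) (Measurable.of_discrete.aemeasurable) hp]
  congr 1
  refine setLIntegral_congr_fun measurableSet_Ioi fun t ht => ?_
  rw [Measure.count_apply (MeasurableSet.of_discrete), approxRank_eq_encard hb (le_of_lt ht)]

theorem trAbsPow_mono_of_approxRank_le (f : HilbertBasis ℕ ℂ E) {p : ℝ} (hp : 0 < p)
    {S T : E →L[ℂ] E} (hS : IsCompactOperator S) (hT : IsCompactOperator T)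
    (h : ∀ t, approxRank S t ≤ approxRank T t) : trAbsPow f S p ≤ trAbsPow f T p := by
  rw [trAbsPow_eq_lintegral f hp hS, trAbsPow_eq_lintegral f hp hT]
  gcongr with t
  exact h t

theorem trAbsPow_comp_left_le (f : HilbertBasis ℕ ℂ E) {p : ℝ} (hp : 0 < p) {T A : E →L[ℂ] E}
    (hT : IsCompactOperator T) {c : ℝ} (hc : 0 < c) (hA : ‖A‖ ≤ c) :
    trAbsPow f (A ∘L T) p ≤ ENNReal.ofReal (c ^ p) * trAbsPow f T p := by
  rw [← trAbsPow_const_smul f hp hT hc.le]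
  exact trAbsPow_mono_of_approxRank_le f hp (hT.clm_comp A) (hT.smul (c : ℂ))
    (approxRank_comp_left_le_smul T hc hA)

theorem trAbsPow_comp_right_le (f : HilbertBasis ℕ ℂ E) {p : ℝ} (hp : 0 < p) {T A : E →L[ℂ] E}
    (hT : IsCompactOperator T) {c : ℝ} (hc : 0 < c) (hA : ‖A‖ ≤ c) :
    trAbsPow f (T ∘L A) p ≤ ENNReal.ofReal (c ^ p) * trAbsPow f T p := by
  rw [← trAbsPow_const_smul f hp hT hc.le]
  exact trAbsPow_mono_of_approxRank_le f hp (hT.comp_clm A) (hT.smul (c : ℂ))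
    (approxRank_comp_right_le_smul T hc hA)

theorem trAbsPow_add_le (f : HilbertBasis ℕ ℂ E) {p : ℝ} (hp : 0 < p) {S T : E →L[ℂ] E}
    (hS : IsCompactOperator S) (hT : IsCompactOperator T) :
    trAbsPow f (S + T) p ≤ ENNReal.ofReal (2 ^ p) * (trAbsPow f S p + trAbsPow f T p) := by
  rw [mul_add, ← trAbsPow_const_smul f hp hS zero_le_two,
    ← trAbsPow_const_smul f hp hT zero_le_two,
    trAbsPow_eq_lintegral f hp (hS.add hT), trAbsPow_eq_lintegral f hp (hS.smul ((2 : ℝ) : ℂ)),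
    trAbsPow_eq_lintegral f hp (hT.smul ((2 : ℝ) : ℂ)), ← mul_add, ← lintegral_add_right]
  · gcongr with t
    rw [← add_mul]
    gcongr
    exact approxRank_add_le_two_smul S T t
  · exact (approxRank_antitone _).measurable.mul (by fun_prop)

theorem trAbsPow_sub_ne_top (f : HilbertBasis ℕ ℂ E) {p : ℝ} (hp : 0 < p) {S T : E →L[ℂ] E}
    (hS : trAbsPow f S p ≠ ⊤) (hT : trAbsPow f T p ≠ ⊤) : trAbsPow f (S - T) p ≠ ⊤ := by
  have hSc := isCompactOperator_of_trAbsPow_ne_top f hp hS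
  have hTc := isCompactOperator_of_trAbsPow_ne_top f hp hT
  have hneg : trAbsPow f (-T) p ≠ ⊤ := by
    have h := trAbsPow_comp_left_le f hp hTc (A := -ContinuousLinearMap.id ℂ E) one_pos
      (by rw [norm_neg]; exact norm_id_le)
    rw [neg_comp, id_comp] at h
    exact ne_top_of_le_ne_top (ENNReal.mul_ne_top ENNReal.ofReal_ne_top hT) h
  rw [sub_eq_add_neg]
  exact ne_top_of_le_ne_top (ENNReal.mul_ne_top ENNReal.ofReal_ne_top
    (ENNReal.add_ne_top.2 ⟨hS, hneg⟩)) (trAbsPow_add_le f hp hSc hTc.neg)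

/-- Dominated convergence for singular values. -/
theorem tendsto_trAbsPow_of_approxRank_le (f : HilbertBasis ℕ ℂ E) {p : ℝ} (hp : 0 < p)
    {K : E →L[ℂ] E} (hK : trAbsPow f K p ≠ ⊤) {α : Type*} {l : Filter α} {S : α → E →L[ℂ] E}
    (hS : ∀ y, IsCompactOperator (S y)) (hSK : ∀ y t, approxRank (S y) t ≤ approxRank K t)
    (h0 : Tendsto (fun y => ‖S y‖) l (𝓝 0)) :
    Tendsto (fun y => trAbsPow f (S y) p) l (𝓝 0) := by
  have hp0 : ENNReal.ofReal p ≠ 0 := (ENNReal.ofReal_pos.2 hp).ne'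
  set g : ℝ → ENNReal := fun t => approxRank K t * ENNReal.ofReal (t ^ (p - 1))
  have hg : ∫⁻ t in Ioi 0, g t ≠ ⊤ := by
    rw [trAbsPow_eq_lintegral f hp (isCompactOperator_of_trAbsPow_ne_top f hp hK)] at hK
    exact fun h => hK (by rw [h, ENNReal.mul_top hp0])
  have hvol : Tendsto (volume.restrict (Ioi (0 : ℝ)) ∘ fun y => Iic ‖S y‖) l (𝓝 0) := by
    have h : Tendsto (fun y => ENNReal.ofReal ‖S y‖) l (𝓝 0) := by
      simpa using ENNReal.tendsto_ofReal h0
    refine h.congr fun y => ?_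
    rw [Function.comp_apply, Measure.restrict_apply measurableSet_Iic, inter_comm, Ioi_inter_Iic,
      Real.volume_Ioc, sub_zero]
  have hlim := ENNReal.Tendsto.const_mul (tendsto_setLIntegral_zero hg hvol)
    (Or.inr (ENNReal.ofReal_ne_top (r := p)))
  rw [mul_zero] at hlim
  refine tendsto_of_tendsto_of_tendsto_of_le_of_le tendsto_const_nhds hlim (fun y => zero_le)
    fun y => ?_
  rw [trAbsPow_eq_lintegral f hp (hS y), ← lintegral_indicator measurableSet_Iic]
  gcongr with t
  by_cases ht : t ≤ ‖S y‖
  · rw [indicator_of_mem (mem_Iic.2 ht)]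
    exact mul_le_mul_left (hSK y t) _
  · rw [approxRank_eq_zero (not_le.1 ht).le, zero_mul]
    exact zero_le

theorem tendsto_trAbsPow_comp_left (f : HilbertBasis ℕ ℂ E) {p : ℝ} (hp : 0 < p)
    {K : E →L[ℂ] E} (hK : trAbsPow f K p ≠ ⊤) {α : Type*} {l : Filter α} {D : α → E →L[ℂ] E}
    {M : ℝ} (hM0 : 0 < M) (hM : ∀ y, ‖D y‖ ≤ M) (hD : ∀ h, Tendsto (fun y => D y h) l (𝓝 0)) :
    Tendsto (fun y => trAbsPow f (D y ∘L K) p) l (𝓝 0) := by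
  have hKc := isCompactOperator_of_trAbsPow_ne_top f hp hK
  refine tendsto_trAbsPow_of_approxRank_le f hp (K := (M : ℂ) • K) ?_
    (fun y => hKc.clm_comp (D y)) (fun y => approxRank_comp_left_le_smul K hM0 (hM y))
    (tendsto_norm_comp_of_isCompactOperator hKc hM0 hM hD)
  rw [trAbsPow_const_smul f hp hKc hM0.le]
  exact ENNReal.mul_ne_top ENNReal.ofReal_ne_top hK

theorem tendsto_trAbsPow_comp_right (f : HilbertBasis ℕ ℂ E) {p : ℝ} (hp : 0 < p)
    {K : E →L[ℂ] E} (hK : trAbsPow f K p ≠ ⊤) {α : Type*} {l : Filter α} {D : α → E →L[ℂ] E}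
    {M : ℝ} (hM0 : 0 < M) (hM : ∀ y, ‖D y‖ ≤ M)
    (hD : ∀ h, Tendsto (fun y => adjoint (D y) h) l (𝓝 0)) :
    Tendsto (fun y => trAbsPow f (K ∘L D y) p) l (𝓝 0) := by
  have hKc := isCompactOperator_of_trAbsPow_ne_top f hp hK
  have hKa : IsCompactOperator (adjoint K) := by
    refine .of_adjoint_comp_self ?_
    rw [adjoint_adjoint]
    exact hKc.comp_clm (adjoint K)
  refine tendsto_trAbsPow_of_approxRank_le f hp (K := (M : ℂ) • K) ?_
    (fun y => hKc.comp_clm (D y)) (fun y => approxRank_comp_right_le_smul K hM0 (hM y)) ?_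
  · rw [trAbsPow_const_smul f hp hKc hM0.le]
    exact ENNReal.mul_ne_top ENNReal.ofReal_ne_top hK
  · refine (tendsto_norm_comp_of_isCompactOperator hKa hM0
      (fun y => ((adjoint (𝕜 := ℂ)).norm_map (D y)).le.trans (hM y)) hD).congr fun y => ?_
    rw [← adjoint_comp, LinearIsometryEquiv.norm_map]

theorem tendsto_sNorm_zero_iff (f : HilbertBasis ℕ ℂ E) {p : ℝ} (hp : 0 < p)
    {α : Type*} {l : Filter α} {S : α → E →L[ℂ] E} (hS : ∀ y, trAbsPow f (S y) p ≠ ⊤) :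
    Tendsto (fun y => sNorm f p (S y)) l (𝓝 0) ↔
      Tendsto (fun y => trAbsPow f (S y) p) l (𝓝 0) := by
  simp only [sNorm, ENNReal.toReal_rpow]
  rw [ENNReal.tendsto_toReal_zero_iff
    fun y => ENNReal.rpow_ne_top_of_nonneg (by positivity) (hS y)]
  constructor
  · intro h
    have := (ENNReal.continuous_rpow_const (y := p)).continuousAt.tendsto.comp h
    simpa [Function.comp_def, ← ENNReal.rpow_mul, hp.ne', hp] using this
  · intro h
    have := (ENNReal.continuous_rpow_const (y := 1 / p)).continuousAt.tendsto.comp h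
    simpa [Function.comp_def, hp] using this

end Schatten

/-- `C₀(X, S_p(H))` is a two-sided ideal in the algebra of bounded
*-strongly continuous `B(H)`-valued maps: both pointwise products `T'T` and `TT'`
remain in `C₀(X, S_p(H))`. -/
theorem c0Schatten_two_sided_ideal {X : Type*} [TopologicalSpace X]
    [LocallyCompactSpace X] [T2Space X]
    (f : HilbertBasis ℕ ℂ H) (p : ℝ) (hp : 1 ≤ p)
    (T : X → H →L[ℂ] H) (hT : IsC0Schatten f p T)
    (T' : X → H →L[ℂ] H) (C : ℝ) (hbound : ∀ x, ‖T' x‖ ≤ C)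
    (hstrong : ∀ h : H, Continuous (fun x => T' x h) ∧
      Continuous (fun x => ContinuousLinearMap.adjoint (T' x) h)) :
    IsC0Schatten f p (fun x => T' x ∘L T x) ∧
    IsC0Schatten f p (fun x => T x ∘L T' x) := by
  have hp0 : 0 < p := one_pos.trans_le hp
  obtain ⟨hfin, hcont, hzero⟩ := hT
  have hc (x : X) := isCompactOperator_of_trAbsPow_ne_top f hp0 (hfin x)
  obtain ⟨c, hc0, hbd⟩ : ∃ c : ℝ, 0 < c ∧ ∀ x, ‖T' x‖ ≤ c :=
    ⟨max C 1, lt_max_of_lt_right one_pos, fun x => (hbound x).trans (le_max_left _ _)⟩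
  have hdiff (x y : X) : ‖T' y - T' x‖ ≤ c + c :=
    (norm_sub_le _ _).trans (add_le_add (hbd y) (hbd x))
  have hsub (x y : X) := trAbsPow_sub_ne_top f hp0 (hfin y) (hfin x)
  have hsubc (x y : X) := isCompactOperator_of_trAbsPow_ne_top f hp0 (hsub x y)
  have hcont' (x : X) := (tendsto_sNorm_zero_iff f hp0 (hsub x)).1 (hcont x)
  have hzero' := (tendsto_sNorm_zero_iff f hp0 hfin).1 hzero
  have hleft (x : X) : trAbsPow f (T' x ∘L T x) p ≤ _ :=
    trAbsPow_comp_left_le f hp0 (hc x) hc0 (hbd x)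
  have hright (x : X) : trAbsPow f (T x ∘L T' x) p ≤ _ :=
    trAbsPow_comp_right_le f hp0 (hc x) hc0 (hbd x)
  have hlfin (x : X) : trAbsPow f (T' x ∘L T x) p ≠ ⊤ :=
    ne_top_of_le_ne_top (ENNReal.mul_ne_top ENNReal.ofReal_ne_top (hfin x)) (hleft x)
  have hrfin (x : X) : trAbsPow f (T x ∘L T' x) p ≠ ⊤ :=
    ne_top_of_le_ne_top (ENNReal.mul_ne_top ENNReal.ofReal_ne_top (hfin x)) (hright x)
  have hconst {α : Type _} {l : Filter α} {u : α → ENNReal} (a : ℝ) (hu : Tendsto u l (𝓝 0)) :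
      Tendsto (fun y => ENNReal.ofReal a * u y) l (𝓝 0) := by
    simpa using ENNReal.Tendsto.const_mul hu (Or.inr (ENNReal.ofReal_ne_top (r := a)))
  refine ⟨⟨hlfin, fun x => ?_, ?_⟩, ⟨hrfin, fun x => ?_, ?_⟩⟩
  · rw [tendsto_sNorm_zero_iff f hp0 fun y => trAbsPow_sub_ne_top f hp0 (hlfin y) (hlfin x)]
    have hD := tendsto_trAbsPow_comp_left f hp0 (hfin x) (add_pos hc0 hc0) (hdiff x)
      (l := 𝓝 x) fun h => by
        simpa using ((hstrong h).1.tendsto x).sub_const (T' x h)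
    have hlim := hconst (2 ^ p) ((hconst (c ^ p) (hcont' x)).add hD |>.trans (by simp))
    refine tendsto_of_tendsto_of_tendsto_of_le_of_le tendsto_const_nhds hlim
      (fun y => zero_le) fun y => ?_
    have hEq : T' y ∘L T y - T' x ∘L T x = T' y ∘L (T y - T x) + (T' y - T' x) ∘L T x := by
      rw [comp_sub, sub_comp, sub_add_sub_cancel]
    dsimp only
    rw [hEq]
    refine (trAbsPow_add_le f hp0 ((hsubc x y).clm_comp _) ((hc x).clm_comp (T' y - T' x))).trans ?_
    gcongr
    exact trAbsPow_comp_left_le f hp0 (hsubc x y) hc0 (hbd y)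
  · rw [tendsto_sNorm_zero_iff f hp0 hlfin]
    exact tendsto_of_tendsto_of_tendsto_of_le_of_le tendsto_const_nhds (hconst _ hzero')
      (fun y => zero_le) hleft
  · rw [tendsto_sNorm_zero_iff f hp0 fun y => trAbsPow_sub_ne_top f hp0 (hrfin y) (hrfin x)]
    have hD := tendsto_trAbsPow_comp_right f hp0 (hfin x) (add_pos hc0 hc0) (hdiff x)
      (l := 𝓝 x) fun h => by
        simpa using ((hstrong h).2.tendsto x).sub_const (adjoint (T' x) h)
    have hlim := hconst (2 ^ p) ((hconst (c ^ p) (hcont' x)).add hD |>.trans (by simp))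
    refine tendsto_of_tendsto_of_tendsto_of_le_of_le tendsto_const_nhds hlim
      (fun y => zero_le) fun y => ?_
    have hEq : T y ∘L T' y - T x ∘L T' x = (T y - T x) ∘L T' y + T x ∘L (T' y - T' x) := by
      rw [comp_sub, sub_comp, sub_add_sub_cancel]
    dsimp only
    rw [hEq]
    refine (trAbsPow_add_le f hp0 ((hsubc x y).comp_clm _) ((hc x).comp_clm _)).trans ?_
    gcongr
    exact trAbsPow_comp_right_le f hp0 (hsubc x y) hc0 (hbd y)
  · rw [tendsto_sNorm_zero_iff f hp0 hrfin]
    exact tendsto_of_tendsto_of_tendsto_of_le_of_le tendsto_const_nhds (hconst _ hzero')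
      (fun y => zero_le) hright

end
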